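/- (Double robustness of ψ1, correctly specified propensity, i = 0) Under the interactive model with both noise conditions, overlap, and D ∈ {0,1} a.s., for every bounded measurable function g : E → ℝ (a possibly misspecified outcome model for the controlled), E[g(Z) + (1 − D) · (Y − g(Z)) / (1 − m0(Z))] = E[g0(0, Z)] = θ0^0. -/

import Mathlib

open MeasureTheory ProbabilityTheory

/-- A factor measurable with respect to `m` integrates to zero against a function whose conditional
expectation given `m` vanishes. -/
lemma integral_mul_eq_zero_of_condExp_eq_zero {Ω : Type*} {m mΩ : MeasurableSpace Ω}
    {μ : Measure Ω} (hm : m ≤ mΩ) [SigmaFinite (μ.trim hm)] {f h : Ω → ℝ}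
    (hf : StronglyMeasurable[m] f) (hfh : Integrable (fun ω => f ω * h ω) μ)
    (hh : Integrable h μ) (h0 : μ[h | m] =ᵐ[μ] 0) : ∫ ω, f ω * h ω ∂μ = 0 := by
  have hpull : μ[fun ω => f ω * h ω | m] =ᵐ[μ] f * μ[h | m] :=
    condExp_mul_of_stronglyMeasurable_left hf hfh hh
  rw [← integral_condExp hm]
  refine integral_eq_zero_of_ae ?_
  filter_upwards [hpull, h0] with ω h1 h2
  simp [h1, h2]

/-- Double robustness of ψ1, correctly specified propensity, i = 0: Under the
interactive model with both noise conditions, overlap and `D ∈ {0,1}` a.s., for every bounded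
measurable `g : E → ℝ`, `E[g(Z) + (1 − D) · (Y − g(Z)) / (1 − m0(Z))] = E[g0(0, Z)] = θ0^0`. -/
theorem stmt_13
    {Ω : Type*} [MeasurableSpace Ω] (P : Measure Ω) [IsProbabilityMeasure P]
    {E : Type*} [MeasurableSpace E]
    (Z : Ω → E) (hZ : Measurable Z)
    (D : Ω → ℝ) (hD : Measurable D) (hD01 : ∀ᵐ ω ∂P, D ω = 0 ∨ D ω = 1)
    (Y : Ω → ℝ) (hY : Integrable Y P)
    (g0 : ℝ × E → ℝ) (hg0 : Measurable g0)
    (m0 : E → ℝ) (hm0 : Measurable m0)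
    (hg0int : Integrable (fun ω => g0 (D ω, Z ω)) P)
    (hg0zint : Integrable (fun ω => g0 (0, Z ω)) P)
    (hm0int : Integrable (fun ω => m0 (Z ω)) P)
    (hxi : P[fun ω => Y ω - g0 (D ω, Z ω) |
        MeasurableSpace.comap (fun ω => (D ω, Z ω)) inferInstance] =ᵐ[P] 0)
    (hnu : P[fun ω => D ω - m0 (Z ω) | MeasurableSpace.comap Z inferInstance] =ᵐ[P] 0)
    (ε : ℝ) (hε : ε ∈ Set.Ioo (0 : ℝ) (1 / 2))
    (hover : ∀ᵐ ω ∂P, ε ≤ m0 (Z ω) ∧ m0 (Z ω) ≤ 1 - ε) :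
    ∀ g : E → ℝ, Measurable g → (∃ C : ℝ, ∀ x, |g x| ≤ C) →
      ∫ ω, (g (Z ω) + (1 - D ω) * (Y ω - g (Z ω)) / (1 - m0 (Z ω))) ∂P =
        ∫ ω, g0 (0, Z ω) ∂P := by
  rintro g hg ⟨C, hC⟩
  obtain ⟨hε0, hε1⟩ := hε
  have hDZ : Measurable fun ω => (D ω, Z ω) := hD.prodMk hZ
  have hDint : Integrable D P := by
    refine Integrable.of_bound hD.aestronglyMeasurable 1 ?_
    filter_upwards [hD01] with ω h
    rcases h with h | h <;> simp [h]
  have hgint : Integrable (fun ω => g (Z ω)) P :=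
    Integrable.of_bound (hg.comp hZ).aestronglyMeasurable C
      (Filter.Eventually.of_forall fun ω => hC (Z ω))
  have hξint : Integrable (fun ω => Y ω - g0 (D ω, Z ω)) P := hY.sub hg0int
  have hνint : Integrable (fun ω => D ω - m0 (Z ω)) P := hDint.sub hm0int
  have hδint : Integrable (fun ω => g0 (0, Z ω) - g (Z ω)) P := hg0zint.sub hgint
  have hwξint : Integrable
      (fun ω => (1 - D ω) / (1 - m0 (Z ω)) * (Y ω - g0 (D ω, Z ω))) P := by
    refine hξint.bdd_mul (c := 1 / ε)
      (Measurable.aestronglyMeasurable (by fun_prop)) ?_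
    filter_upwards [hD01, hover] with ω h ⟨_, h2⟩
    have hpos : 0 < 1 - m0 (Z ω) := by linarith
    rw [Real.norm_eq_abs, abs_div, abs_of_pos hpos]
    refine div_le_div₀ zero_le_one ?_ hε0 (by linarith)
    rcases h with h | h <;> simp [h]
  have hwνint : Integrable
      (fun ω => (g0 (0, Z ω) - g (Z ω)) / (1 - m0 (Z ω)) * (D ω - m0 (Z ω))) P := by
    have hbdd : Integrable (fun ω => (D ω - m0 (Z ω)) / (1 - m0 (Z ω)) *
        (g0 (0, Z ω) - g (Z ω))) P := by
      refine hδint.bdd_mul (c := 1 / ε)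
        (Measurable.aestronglyMeasurable (by fun_prop)) ?_
      filter_upwards [hD01, hover] with ω h ⟨h1, h2⟩
      have hpos : 0 < 1 - m0 (Z ω) := by linarith
      rw [Real.norm_eq_abs, abs_div, abs_of_pos hpos]
      refine div_le_div₀ zero_le_one ?_ hε0 (by linarith)
      rw [abs_le]
      rcases h with h | h <;> rw [h] <;> constructor <;> linarith
    exact hbdd.congr (Filter.Eventually.of_forall fun ω => by ring)
  have hξ0 : ∫ ω, (1 - D ω) / (1 - m0 (Z ω)) * (Y ω - g0 (D ω, Z ω)) ∂P = 0 := by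
    refine integral_mul_eq_zero_of_condExp_eq_zero hDZ.comap_le ?_ hwξint hξint hxi
    have hw : Measurable fun p : ℝ × E => (1 - p.1) / (1 - m0 p.2) := by fun_prop
    exact (hw.comp (comap_measurable fun ω => (D ω, Z ω))).stronglyMeasurable
  have hν0 : ∫ ω, (g0 (0, Z ω) - g (Z ω)) / (1 - m0 (Z ω)) * (D ω - m0 (Z ω)) ∂P = 0 := by
    refine integral_mul_eq_zero_of_condExp_eq_zero hZ.comap_le ?_ hwνint hνint hnu
    have hw : Measurable fun z : E => (g0 (0, z) - g z) / (1 - m0 z) := by fun_prop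
    exact (hw.comp (comap_measurable Z)).stronglyMeasurable
  have hdecomp : (fun ω => g (Z ω) + (1 - D ω) * (Y ω - g (Z ω)) / (1 - m0 (Z ω))) =ᵐ[P]
      fun ω => (1 - D ω) / (1 - m0 (Z ω)) * (Y ω - g0 (D ω, Z ω)) -
        (g0 (0, Z ω) - g (Z ω)) / (1 - m0 (Z ω)) * (D ω - m0 (Z ω)) + g0 (0, Z ω) := by
    filter_upwards [hD01, hover] with ω h ⟨_, h2⟩
    have hne : 1 - m0 (Z ω) ≠ 0 := by linarith
    rcases h with h | h <;> rw [h] <;> field_simp <;> ring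
  rw [integral_congr_ae hdecomp, integral_add (by exact hwξint.sub hwνint) hg0zint,
    integral_sub hwξint hwνint, hξ0, hν0]
  ring
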